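/- arXiv:2211.07691 — 3 statements merged into one kernel-verified Lean document; each statement's English description precedes it below -/
import Mathlib

section
/- Let q be a prime power, let d, k be positive integers with d ≤ q and d ≥ 2k + 1, and let F be any field. Suppose NW_{q,d,k} = Σ_{i=1}^s ∏_{j=1}^{d} L_{i,j}, where each L_{i,j} is a homogeneous linear form in the q·d variables over F. Then s ≥ q^k. -/
open MvPolynomial

/-- The iterated partial derivative operator `∂_m` associated to the exponent vector `m`. -/
noncomputable def iterDeriv {σv F : Type*} [CommRing F] (m : σv →₀ ℕ) :
    Module.End F (MvPolynomial σv F) :=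
  (m.support.toList.map
    (fun i => ((MvPolynomial.pderiv i).toLinearMap : Module.End F (MvPolynomial σv F)) ^ m i)).prod

/-- `∂^k P` : the set of all partial derivatives of `P` of order `k`. -/
noncomputable def partialsSet {σv F : Type*} [CommRing F] (k : ℕ) (P : MvPolynomial σv F) :
    Set (MvPolynomial σv F) :=
  { g | ∃ m : σv →₀ ℕ, (m.sum fun _ e => e) = k ∧ g = iterDeriv m P }

/-- `x^ℓ · ∂^k P` : degree-`ℓ` monomial multiples of order-`k` partial derivatives of `P`. -/
noncomputable def shiftedPartialsSet {σv F : Type*} [CommRing F] (ℓ k : ℕ)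
    (P : MvPolynomial σv F) : Set (MvPolynomial σv F) :=
  { q | ∃ m : σv →₀ ℕ, (m.sum fun _ e => e) = ℓ ∧
      ∃ g ∈ partialsSet k P, q = MvPolynomial.monomial m (1 : F) * g }

/-- The shifted partials measure `SP_{k,ℓ}`. -/
noncomputable def SP {σv F : Type*} [Field F] (k ℓ : ℕ) (P : MvPolynomial σv F) : ℕ :=
  Module.finrank F (Submodule.span F (shiftedPartialsSet ℓ k P))

/-- The affine projections of partials measure `APP_{k,n₀}`. -/
noncomputable def APP {σv F : Type*} [Field F] (k n0 : ℕ) (P : MvPolynomial σv F) : ℕ :=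
  sSup { r : ℕ | ∃ L : σv → MvPolynomial (Fin n0) F, (∀ i, (L i).IsHomogeneous 1) ∧
    r = Module.finrank F (Submodule.span F
          ((fun g => MvPolynomial.aeval L g) '' partialsSet k P)) }

/-- `residue_k(d_1,…,d_t)`. -/
noncomputable def residue {t : ℕ} (k : ℕ) (ds : Fin t → ℕ) : ℝ :=
  (1 / 2) * sInf { r : ℝ | ∃ κ : Fin t → ℤ,
    r = ∑ i, |(κ i : ℝ) - ((k : ℝ) / ((∑ i, ds i : ℕ) : ℝ)) * (ds i : ℝ)| }

/-- `M(a,b) = C(a+b−1, b)`, the number of monic monomials of degree `b` in `a` variables. -/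
def M (a b : ℕ) : ℕ := Nat.choose (a + b - 1) b

/-- The Nisan–Wigderson design polynomial `NW_{q,d,k}`, where the finite field `F_q` is
represented by a finite field `K` (with `q = Fintype.card K`), the injection of `[d]` into
`F_q` is `ι`, and polynomials `h ∈ F_q[z]` of degree `< k` are parametrized by their
coefficient vectors `c : Fin k → K`. The variables are indexed by `Fin d × K`. -/
noncomputable def NW (K : Type*) [Field K] [Fintype K] (d k : ℕ) (ι : Fin d → K)
    (F : Type*) [Field F] : MvPolynomial (Fin d × K) F :=
  ∑ c : Fin k → K, ∏ i : Fin d, MvPolynomial.X (i, ∑ j : Fin k, c j * ι i ^ (j : ℕ))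

section

open Finset

/-- The span of all products of exactly `n` of the factors within one row of `L`. -/
noncomputable def subproductSpan {I J σv F : Type*} [Field F]
    (L : I → J → MvPolynomial σv F) (n : ℕ) : Submodule F (MvPolynomial σv F) :=
  Submodule.span F (Set.range fun p : I × {T : Finset J // T.card = n} => ∏ j ∈ p.2.1, L p.1 j)

lemma prod_mem_subproductSpan {I J σv F : Type*} [Field F]
    (L : I → J → MvPolynomial σv F) (i : I) (T : Finset J) :
    ∏ j ∈ T, L i j ∈ subproductSpan L T.card :=
  Submodule.subset_span ⟨(i, ⟨T, rfl⟩), rfl⟩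

lemma finrank_subproductSpan_le {I J σv F : Type*} [Field F] [Fintype I] [Fintype J]
    (L : I → J → MvPolynomial σv F) (n : ℕ) :
    Module.finrank F (subproductSpan L n) ≤ Fintype.card I * (Fintype.card J).choose n := by
  classical
  refine (finrank_range_le_card _).trans_eq ?_
  rw [Fintype.card_prod, Fintype.card_finset_len]

lemma derivation_prod {R A J : Type*} [CommSemiring R] [CommSemiring A] [Algebra R A]
    [DecidableEq J] (D : Derivation R A A) (f : J → A) (T : Finset J) :
    D (∏ j ∈ T, f j) = ∑ j ∈ T, D (f j) * ∏ l ∈ T.erase j, f l := by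
  induction T using Finset.induction_on with
  | empty => simp
  | insert a T ha ih =>
    rw [prod_insert ha, D.leibniz, ih, sum_insert ha, erase_insert ha, smul_eq_mul, smul_eq_mul,
      mul_sum, add_comm, mul_comm]
    congr 1
    refine sum_congr rfl fun j hj => ?_
    have hja : a ≠ j := fun h => ha (h ▸ hj)
    rw [erase_insert_of_ne hja, prod_insert (fun h => ha (mem_of_mem_erase h))]
    ring

lemma pderiv_mem_subproductSpan {I J σv F : Type*} [Field F]
    {L : I → J → MvPolynomial σv F} (hL : ∀ i j, (L i j).IsHomogeneous 1) (v : σv) {n : ℕ}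
    {P : MvPolynomial σv F} (hP : P ∈ subproductSpan L (n + 1)) :
    pderiv v P ∈ subproductSpan L n := by
  classical
  induction hP using Submodule.span_induction with
  | mem x hx =>
    obtain ⟨⟨i, T, hT⟩, rfl⟩ := hx
    dsimp only
    rw [derivation_prod]
    refine Submodule.sum_mem _ fun j hj => ?_
    have hconst : pderiv v (L i j) = C ((pderiv v (L i j)).coeff 0) := by
      rw [← totalDegree_eq_zero_iff_eq_C, totalDegree_zero_iff_isHomogeneous]
      exact (hL i j).pderiv
    have hcard : (T.erase j).card = n := by rw [card_erase_of_mem hj, hT]; rfl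
    rw [hconst, ← smul_eq_C_mul, ← hcard]
    exact Submodule.smul_mem _ _ (prod_mem_subproductSpan L i _)
  | zero => simp
  | add x y _ _ hx hy => rw [map_add]; exact Submodule.add_mem _ hx hy
  | smul a x _ hx => rw [Derivation.map_smul]; exact Submodule.smul_mem _ _ hx

lemma pderiv_prod_X_pair {J K F : Type*} [Field F] [DecidableEq J] [DecidableEq K]
    (h : J → K) {T : Finset J} {a : J} (ha : a ∈ T) (b : K) :
    pderiv (a, b) (∏ j ∈ T, (X (j, h j) : MvPolynomial (J × K) F)) =
      if h a = b then ∏ j ∈ T.erase a, X (j, h j) else 0 := by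
  rw [derivation_prod, sum_eq_single_of_mem a ha]
  · by_cases hb : h a = b
    · simp [hb]
    · rw [pderiv_X_of_ne (by simpa using hb), zero_mul, if_neg hb]
  · intro j _ hj
    rw [pderiv_X_of_ne (by simp [hj]), zero_mul]

/-- Differentiating a sum of products of variables along the coordinates of one summand
retains the summands that agree with it on the chosen positions. -/
lemma sum_agreeing_mem_subproductSpan {A I J K F : Type*} [Field F] [Fintype A] [Fintype J]
    [DecidableEq J] [DecidableEq K]
    {L : I → J → MvPolynomial (J × K) F} (hL : ∀ i j, (L i j).IsHomogeneous 1)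
    (H : A → J → K)
    (hmem : ∑ c, ∏ j, X (j, H c j) ∈ subproductSpan L (Fintype.card J))
    (c : A) (S : Finset J) :
    ∑ c' : A, (if ∀ j ∈ S, H c' j = H c j then
      ∏ j ∈ Sᶜ, (X (j, H c' j) : MvPolynomial (J × K) F) else 0)
      ∈ subproductSpan L (Sᶜ).card := by
  induction S using Finset.induction_on with
  | empty => simpa using hmem
  | insert a S ha ih =>
    have haS : a ∈ Sᶜ := mem_compl.mpr ha
    rw [compl_insert]
    rw [← card_erase_add_one haS] at ih
    convert pderiv_mem_subproductSpan hL (a, H c a) ih using 1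
    rw [map_sum]
    refine sum_congr rfl fun c' _ => ?_
    rw [apply_ite (pderiv (a, H c a)), pderiv_prod_X_pair _ haS, map_zero, ← ite_and]
    refine if_congr ?_ rfl rfl
    rw [forall_mem_insert, and_comm]

lemma prod_X_mem_subproductSpan {A I J K F : Type*} [Field F] [Fintype A] [Fintype J]
    [DecidableEq J]
    {L : I → J → MvPolynomial (J × K) F} (hL : ∀ i j, (L i j).IsHomogeneous 1)
    (H : A → J → K)
    (hmem : ∑ c, ∏ j, X (j, H c j) ∈ subproductSpan L (Fintype.card J))
    (T : Finset J) (hT : ∀ c c' : A, (∀ j ∈ Tᶜ, H c j = H c' j) → c = c') (c : A) :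
    ∏ j ∈ T, (X (j, H c j) : MvPolynomial (J × K) F) ∈ subproductSpan L T.card := by
  classical
  have h := sum_agreeing_mem_subproductSpan hL H hmem c Tᶜ
  rw [compl_compl, sum_eq_single_of_mem c (mem_univ c)] at h
  · simpa using h
  · intro c' _ hne
    exact if_neg fun hagree => hne (hT _ _ hagree)

lemma linearIndependent_prod_X {A J K F : Type*} [Field F] (H : A → J → K) (n : ℕ)
    (hn : ∀ T : Finset J, T.card = n → ∀ c c' : A, (∀ j ∈ T, H c j = H c' j) → c = c') :
    LinearIndependent F (fun p : A × {T : Finset J // T.card = n} =>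
      ∏ j ∈ p.2.1, (X (j, H p.1 j) : MvPolynomial (J × K) F)) := by
  classical
  let e : A × {T : Finset J // T.card = n} → (J × K →₀ ℕ) :=
    fun p => ∑ j ∈ p.2.1, Finsupp.single (j, H p.1 j) 1
  have he : ∀ p j b, e p (j, b) = if j ∈ p.2.1 ∧ H p.1 j = b then 1 else 0 := by
    intro p j b
    simp only [e, Finsupp.finsetSum_apply, Finsupp.single_apply, Prod.mk.injEq, ite_and,
      sum_ite_eq']
  have hmem : ∀ p q, e p = e q → ∀ j ∈ p.2.1, j ∈ q.2.1 ∧ H q.1 j = H p.1 j := by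
    intro p q hpq j hj
    have h := DFunLike.congr_fun hpq (j, H p.1 j)
    rw [he, he, if_pos ⟨hj, rfl⟩] at h
    by_contra hcon
    rw [if_neg hcon] at h
    exact one_ne_zero h
  have hinj : Function.Injective e := by
    rintro ⟨c, T, hT⟩ ⟨c', T', hT'⟩ hpq
    have hsub := hmem _ _ hpq
    have hTT : T = T' := eq_of_subset_of_card_le (fun j hj => (hsub j hj).1) (by rw [hT, hT'])
    subst hTT
    rw [hn T hT c c' fun j hj => (hsub j hj).2.symm]
  have hlin := (basisMonomials (J × K) F).linearIndependent.comp e hinj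
  have hmon : (basisMonomials (J × K) F) ∘ e = fun p => ∏ j ∈ p.2.1, X (j, H p.1 j) := by
    funext p
    rw [Function.comp_apply, coe_basisMonomials]
    exact monomial_sum_one _ _
  rwa [hmon] at hlin

/-- If any `k` positions determine a word, then writing the sum of the corresponding products of
variables as a sum of products of linear forms takes as many products as there are words. -/
theorem card_le_of_sum_prod_X_eq {A I J K F : Type*} [Field F] [Fintype A] [Fintype I]
    [Fintype J] (H : A → J → K) (k : ℕ) (hk : 2 * k ≤ Fintype.card J)
    (hH : ∀ T : Finset J, k ≤ T.card → ∀ c c' : A, (∀ j ∈ T, H c j = H c' j) → c = c')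
    (L : I → J → MvPolynomial (J × K) F) (hL : ∀ i j, (L i j).IsHomogeneous 1)
    (heq : ∑ c, ∏ j, X (j, H c j) = ∑ i, ∏ j, L i j) :
    Fintype.card A ≤ Fintype.card I := by
  classical
  set n := Fintype.card J - k with hn
  have hmem : ∑ c, ∏ j, X (j, H c j) ∈ subproductSpan L (Fintype.card J) := by
    rw [heq]
    exact Submodule.sum_mem _ fun i _ => prod_mem_subproductSpan L i univ
  have hlin := linearIndependent_prod_X (F := F) H n fun T hT => hH T (by omega)
  have hsub : Submodule.span F (Set.range fun p : A × {T : Finset J // T.card = n} =>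
      ∏ j ∈ p.2.1, (X (j, H p.1 j) : MvPolynomial (J × K) F)) ≤ subproductSpan L n := by
    rw [Submodule.span_le]
    rintro _ ⟨⟨c, T, hT⟩, rfl⟩
    have h := prod_X_mem_subproductSpan hL H hmem T (hH _ (by rw [card_compl]; omega)) c
    rwa [hT] at h
  have : Module.Finite F (subproductSpan L n) :=
    FiniteDimensional.span_of_finite F (Set.finite_range _)
  have hle := (Submodule.finrank_mono hsub).trans (finrank_subproductSpan_le L n)
  rw [finrank_span_eq_card hlin, Fintype.card_prod, Fintype.card_finset_len] at hle
  exact Nat.le_of_mul_le_mul_right hle (Nat.choose_pos (by omega))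

lemma eq_of_forall_mem_sum_mul_pow_eq {K J : Type*} [Field K] {k : ℕ} {ι : J → K}
    (hι : Function.Injective ι) (T : Finset J) (hT : k ≤ T.card) (c c' : Fin k → K)
    (h : ∀ i ∈ T, ∑ j, c j * ι i ^ (j : ℕ) = ∑ j, c' j * ι i ^ (j : ℕ)) : c = c' := by
  let e : Fin k → J := fun i => (T.equivFin.symm (Fin.castLE hT i) : J)
  have he : Function.Injective e := Subtype.val_injective.comp
    (T.equivFin.symm.injective.comp (Fin.castLE_injective hT))
  refine sub_eq_zero.mp
    (Matrix.eq_zero_of_forall_index_sum_mul_pow_eq_zero (hι.comp he) fun i => ?_)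
  simp only [Pi.sub_apply, Function.comp_apply, sub_mul, sum_sub_distrib]
  exact sub_eq_zero.mpr (h _ (Subtype.prop _))

end

/-- homogeneous depth-`2` (ΣΠ of linear forms) lower bound for `NW`. -/
theorem stmt13 (K : Type*) [Field K] [Fintype K] (d k : ℕ) (hk : 0 < k)
    (hdq : d ≤ Fintype.card K) (h2k : 2 * k + 1 ≤ d)
    (ι : Fin d → K) (hι : Function.Injective ι)
    (F : Type*) [Field F]
    (s : ℕ) (L : Fin s → Fin d → MvPolynomial (Fin d × K) F)
    (hL : ∀ i j, (L i j).IsHomogeneous 1)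
    (heq : NW K d k ι F = ∑ i, ∏ j, L i j) :
    Fintype.card K ^ k ≤ s := by
  simpa using card_le_of_sum_prod_X_eq (fun (c : Fin k → K) i => ∑ j : Fin k, c j * ι i ^ (j : ℕ))
    k (by rw [Fintype.card_fin]; omega) (eq_of_forall_mem_sum_mul_pow_eq hι) L hL heq
end

section
/- Let F be a field of characteristic 0, let y = {y_1,…,y_{n_1}} and z = {z_1,…,z_{n_0}} be disjoint sets of variables, and let k < d be positive integers. Let M_y be the set of monic monomials of degree k in the y variables, let M_z be the set of monic monomials of degree d−k in the z variables, and let σ : M_y → M_z be an injective map. Define P_σ := Σ_{m ∈ M_y} m·σ(m) ∈ F[y, z]. Then the dimension of the F-linear span of the set { (∂_X P_σ) with all y variables substituted by 0 : X a monic monomial of degree k in the variables y ∪ z } is at least M(n_1, k); in particular, APP_{k,n_0}(P_σ) ≥ M(n_1, k). -/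
open MvPolynomial

/-- The monomial (in the combined variables `Fin n1 ⊕ Fin n0`) corresponding to a degree-`k`
multiset of `y`-variables. -/
noncomputable def yMonomial {F : Type*} [Field F] {n1 n0 k : ℕ} (s : Sym (Fin n1) k) :
    MvPolynomial (Fin n1 ⊕ Fin n0) F :=
  ((s : Multiset (Fin n1)).map fun i => (MvPolynomial.X (Sum.inl i))).prod

/-- The monomial (in the combined variables `Fin n1 ⊕ Fin n0`) corresponding to a degree-`m`
multiset of `z`-variables. -/
noncomputable def zMonomial {F : Type*} [Field F] {n1 n0 m : ℕ} (s : Sym (Fin n0) m) :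
    MvPolynomial (Fin n1 ⊕ Fin n0) F :=
  ((s : Multiset (Fin n0)).map fun j => (MvPolynomial.X (Sum.inr j))).prod

/-- The polynomial `P_σ := Σ_{m ∈ M_y} m · σ(m)`. -/
noncomputable def Psigma {F : Type*} [Field F] (n1 n0 d k : ℕ)
    (σm : Sym (Fin n1) k → Sym (Fin n0) (d - k)) : MvPolynomial (Fin n1 ⊕ Fin n0) F :=
  ∑ s : Sym (Fin n1) k, (yMonomial (n0 := n0) s) * (zMonomial (n1 := n1) (σm s))

theorem pderiv_pow_monomial {σv F : Type*} [CommRing F] (i : σv) (e : ℕ) (n : σv →₀ ℕ) (c : F) :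
    (((pderiv i).toLinearMap : Module.End F (MvPolynomial σv F)) ^ e) (monomial n c) =
      monomial (n - Finsupp.single i e) (c * ((n i).descFactorial e : F)) := by
  induction e with
  | zero => simp
  | succ e ih =>
    rw [pow_succ', Module.End.mul_apply, ih]
    simp only [Derivation.coeFn_coe, pderiv_monomial, tsub_tsub, ← Finsupp.single_add,
      Finsupp.tsub_apply, Finsupp.single_eq_same, Nat.descFactorial_succ]
    push_cast
    ring_nf

theorem list_prod_pderiv_pow_monomial {σv F : Type*} [CommRing F] (m n : σv →₀ ℕ) (c : F)
    (l : List σv) (hl : l.Nodup) :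
    (l.map (fun i =>
      ((pderiv i).toLinearMap : Module.End F (MvPolynomial σv F)) ^ m i)).prod (monomial n c) =
      monomial (n - (l.map fun i => Finsupp.single i (m i)).sum)
        (c * (l.map fun i => ((n i).descFactorial (m i) : F)).prod) := by
  induction l with
  | nil => simp
  | cons a l ih =>
    obtain ⟨ha, hl'⟩ := List.nodup_cons.1 hl
    have hz : (l.map fun i => Finsupp.single i (m i)).sum a = 0 := by
      clear ih hl hl'
      induction l with
      | nil => simp
      | cons b l ih =>
        simp only [List.mem_cons, not_or] at ha
        simp [ih ha.2, Finsupp.single_eq_of_ne ha.1]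
    rw [List.map_cons, List.prod_cons, Module.End.mul_apply, ih hl', pderiv_pow_monomial,
      Finsupp.tsub_apply, hz, tsub_zero, tsub_tsub, List.map_cons, List.sum_cons, List.map_cons,
      List.prod_cons, add_comm, mul_assoc, mul_comm (List.prod _)]

theorem iterDeriv_monomial {σv F : Type*} [CommRing F] (m n : σv →₀ ℕ) (c : F) :
    iterDeriv m (monomial n c) =
      monomial (n - m) (c * ∏ i ∈ m.support, ((n i).descFactorial (m i) : F)) := by
  rw [iterDeriv, list_prod_pderiv_pow_monomial _ _ _ _ (Finset.nodup_toList _),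
    Finset.sum_map_toList, Finset.prod_map_toList]
  congr
  exact m.sum_single

theorem prod_map_X_eq_monomial {σv τ F : Type*} [CommRing F] [DecidableEq τ] (f : τ → σv)
    (s : Multiset τ) :
    (s.map fun i => (X (f i) : MvPolynomial σv F)).prod =
      monomial (Finsupp.mapDomain f (Multiset.toFinsupp s)) 1 := by
  induction s using Multiset.induction_on with
  | empty => simp
  | cons a s ih =>
    rw [Multiset.map_cons, Multiset.prod_cons, ih, ← Multiset.singleton_add, map_add,
      Multiset.toFinsupp_singleton, Finsupp.mapDomain_add, Finsupp.mapDomain_single, X,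
      monomial_mul, one_mul]

/-- The exponent vector, in the combined variables, of a multiset of `y`-variables. -/
noncomputable def yExponent {n1 k : ℕ} (n0 : ℕ) (s : Sym (Fin n1) k) : Fin n1 ⊕ Fin n0 →₀ ℕ :=
  Finsupp.mapDomain Sum.inl (Multiset.toFinsupp (s : Multiset (Fin n1)))

theorem yExponent_inl {n1 n0 k : ℕ} (s : Sym (Fin n1) k) (i : Fin n1) :
    yExponent n0 s (Sum.inl i) = (s : Multiset (Fin n1)).count i := by
  rw [yExponent, Finsupp.mapDomain_apply Sum.inl_injective, Multiset.toFinsupp_apply]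

theorem yExponent_inr {n1 n0 k : ℕ} (s : Sym (Fin n1) k) (j : Fin n0) :
    yExponent n0 s (Sum.inr j) = 0 :=
  Finsupp.mapDomain_of_notMem_range _ _ (by simp)

theorem sum_yExponent {n1 n0 k : ℕ} (s : Sym (Fin n1) k) :
    ((yExponent n0 s).sum fun _ e => e) = k := by
  rw [yExponent, Finsupp.sum_mapDomain_index (by simp) (by simp)]
  exact (Multiset.toFinsupp_sum_eq _).trans s.2

theorem iterDeriv_yExponent_mul_of_ne {F : Type*} [Field F] {n1 n0 k m : ℕ}
    {s t : Sym (Fin n1) k} (hst : t ≠ s) (u : Sym (Fin n0) m) :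
    iterDeriv (yExponent n0 s)
      (yMonomial (n0 := n0) t * zMonomial (n1 := n1) u : MvPolynomial (Fin n1 ⊕ Fin n0) F) = 0 := by
  obtain ⟨i, hi⟩ : ∃ i, (t : Multiset (Fin n1)).count i < (s : Multiset (Fin n1)).count i := by
    by_contra! h
    exact hst (Sym.coe_injective
      (Multiset.eq_of_le_of_card_le (Multiset.le_iff_count.2 h) (by simp))).symm
  rw [yMonomial, zMonomial, prod_map_X_eq_monomial, prod_map_X_eq_monomial, monomial_mul,
    iterDeriv_monomial, Finset.prod_eq_zero (i := Sum.inl i), mul_zero, map_zero]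
  · rw [Finsupp.mem_support_iff, yExponent_inl]
    omega
  · rw [← yExponent, Finsupp.add_apply, yExponent_inl, yExponent_inl,
      Finsupp.mapDomain_of_notMem_range _ _ (by simp), add_zero, Nat.descFactorial_of_lt hi,
      Nat.cast_zero]

theorem iterDeriv_yExponent_mul_self {F : Type*} [Field F] [CharZero F] {n1 n0 k m : ℕ}
    (s : Sym (Fin n1) k) (u : Sym (Fin n0) m) :
    ∃ c : F, c ≠ 0 ∧ iterDeriv (yExponent n0 s)
      (yMonomial (F := F) (n0 := n0) s * zMonomial (n1 := n1) u) = c • zMonomial (n1 := n1) u := by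
  refine ⟨∏ i ∈ (yExponent n0 s).support, ((yExponent n0 s i).factorial : F),
    Finset.prod_ne_zero_iff.2 fun i _ => Nat.cast_ne_zero.2 (Nat.factorial_ne_zero _), ?_⟩
  rw [yMonomial, zMonomial, prod_map_X_eq_monomial, prod_map_X_eq_monomial, monomial_mul,
    iterDeriv_monomial, smul_monomial, ← yExponent, add_tsub_cancel_left, one_mul, one_mul,
    smul_eq_mul, mul_one]
  congr 1
  refine Finset.prod_congr rfl fun i hi => ?_
  rcases i with i | j
  · rw [Finsupp.add_apply, Finsupp.mapDomain_of_notMem_range _ _ (by simp), add_zero,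
      Nat.descFactorial_self]
  · exact absurd (yExponent_inr s j) (Finsupp.mem_support_iff.1 hi)

theorem exists_iterDeriv_Psigma {F : Type*} [Field F] [CharZero F] {n1 n0 d k : ℕ}
    (σm : Sym (Fin n1) k → Sym (Fin n0) (d - k)) (s : Sym (Fin n1) k) :
    ∃ c : F, c ≠ 0 ∧ iterDeriv (yExponent n0 s) (Psigma (F := F) n1 n0 d k σm) =
      c • zMonomial (n1 := n1) (σm s) := by
  obtain ⟨c, hc, h⟩ := iterDeriv_yExponent_mul_self (F := F) s (σm s)
  refine ⟨c, hc, ?_⟩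
  rw [Psigma, map_sum, Finset.sum_eq_single s
    (fun t _ ht => iterDeriv_yExponent_mul_of_ne ht _) (by simp), h]

theorem finite_partialsSet {σv F : Type*} [Finite σv] [CommRing F] (k : ℕ)
    (P : MvPolynomial σv F) : (partialsSet k P).Finite := by
  classical
  have := Fintype.ofFinite σv
  refine ((Finset.finsuppAntidiag Finset.univ k).finite_toSet.image
    fun m => iterDeriv m P).subset ?_
  rintro g ⟨m, hm, rfl⟩
  refine ⟨m, ?_, rfl⟩
  rw [Finset.mem_coe, Finset.mem_finsuppAntidiag]
  exact ⟨by rw [← hm, Finsupp.sum_fintype _ _ (by simp)], Finset.subset_univ _⟩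

/-- Killing the `y`-variables and sending the `z`-variables to algebraically independent elements
leaves at least `M n1 k` linearly independent order-`k` partial derivatives of `P_σ`. -/
theorem M_le_finrank_span_partials {F A : Type*} [Field F] [CharZero F] [CommRing A] [Algebra F A]
    {n1 n0 d k : ℕ} {σm : Sym (Fin n1) k → Sym (Fin n0) (d - k)} (hσ : Function.Injective σm)
    {w : Fin n0 → A} (hw : AlgebraicIndependent F w) :
    M n1 k ≤ Module.finrank F (Submodule.span F
      ((fun g => aeval (Sum.elim (fun _ : Fin n1 => (0 : A)) w) g) ''
        partialsSet k (Psigma (F := F) n1 n0 d k σm))) := by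
  set φ : MvPolynomial (Fin n1 ⊕ Fin n0) F →ₐ[F] A := aeval (Sum.elim (fun _ => (0 : A)) w)
  set V := Submodule.span F ((fun g => φ g) '' partialsSet k (Psigma (F := F) n1 n0 d k σm))
  have : Module.Finite F V := Module.Finite.span_of_finite F ((finite_partialsSet _ _).image _)
  let v (s : Sym (Fin n1) k) : A :=
    aeval w (monomial (Multiset.toFinsupp (σm s : Multiset (Fin n0))) (1 : F))
  have hφ (s) : φ (zMonomial (n1 := n1) (σm s)) = v s := by
    have h := prod_map_X_eq_monomial (F := F) id (σm s : Multiset (Fin n0))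
    rw [Finsupp.mapDomain_id] at h
    simp only [v, ← h, zMonomial, map_multiset_prod, Multiset.map_map]
    simp [φ, Function.comp_def]
  have hv (s) : v s ∈ V := by
    obtain ⟨c, hc, h⟩ := exists_iterDeriv_Psigma (F := F) σm s
    rw [← V.smul_mem_iff hc, ← hφ, ← map_smul, ← h]
    exact Submodule.subset_span ⟨_, ⟨_, sum_yExponent s, rfl⟩, rfl⟩
  have hli : LinearIndependent F v := by
    have h := (basisMonomials (Fin n0) F).linearIndependent.comp
      (fun s => Multiset.toFinsupp (σm s : Multiset (Fin n0)))
      (Multiset.toFinsupp.injective.comp (Sym.coe_injective.comp hσ))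
    rw [coe_basisMonomials] at h
    exact h.map' (aeval w).toLinearMap (LinearMap.ker_eq_bot.2 hw)
  have hli' : LinearIndependent F fun s => (⟨v s, hv s⟩ : V) :=
    LinearIndependent.of_comp V.subtype hli
  calc M n1 k = Fintype.card (Sym (Fin n1) k) := by
        rw [Sym.card_sym_eq_choose, Fintype.card_fin, M]
    _ ≤ _ := hli'.fintype_card_le_finrank

theorem finrank_le_APP {σv F : Type*} [Finite σv] [Field F] (k n0 : ℕ) (P : MvPolynomial σv F)
    (L : σv → MvPolynomial (Fin n0) F) (hL : ∀ i, (L i).IsHomogeneous 1) :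
    Module.finrank F (Submodule.span F ((fun g => aeval L g) '' partialsSet k P)) ≤
      APP k n0 P := by
  refine le_csSup ⟨(partialsSet k P).ncard, ?_⟩ ⟨L, hL, rfl⟩
  rintro r ⟨L, -, rfl⟩
  have hfin := finite_partialsSet k P
  have := (hfin.image fun g => aeval L g).fintype
  refine (finrank_span_le_card _).trans ?_
  rw [← Set.ncard_eq_toFinset_card']
  exact Set.ncard_image_le hfin

/-- a non-set-multilinear hard polynomial for `APP`. -/
theorem stmt14 {F : Type*} [Field F] [CharZero F] (n1 n0 d k : ℕ)
    (hk : 0 < k) (hkd : k < d)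
    (σm : Sym (Fin n1) k → Sym (Fin n0) (d - k)) (hσ : Function.Injective σm) :
    M n1 k ≤
      Module.finrank F (Submodule.span F
        ((fun g => MvPolynomial.aeval
            (Sum.elim (fun _ : Fin n1 => (0 : MvPolynomial (Fin n1 ⊕ Fin n0) F))
              (fun j : Fin n0 => MvPolynomial.X (Sum.inr j))) g) ''
          partialsSet k (Psigma (F := F) n1 n0 d k σm))) ∧
    M n1 k ≤ APP k n0 (Psigma (F := F) n1 n0 d k σm) := by
  refine ⟨M_le_finrank_span_partials hσ ?_,
    (M_le_finrank_span_partials hσ (algebraicIndependent_X (Fin n0) F)).trans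
      (finrank_le_APP _ _ _ _ ?_)⟩
  · exact (algebraicIndependent_X (Fin n1 ⊕ Fin n0) F).comp Sum.inr Sum.inr_injective
  · rintro (i | j)
    · exact isHomogeneous_zero _ _ _
    · exact isHomogeneous_X _ _
end

section
/- There exists an absolute constant c > 0 such that the following holds. Let F be a field and let n, d be positive integers with 2e·d ≤ n (where e is Euler's number). Suppose x_1·x_2⋯x_n = Σ_{i=1}^s Q_i^{e_i}, where each Q_i ∈ F[x_1,…,x_n] has degree at most d and each e_i is a positive integer. Then s ≥ 2^{c·n/d}. -/
open MvPolynomial Finset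

lemma Nat.pow_le_choose_of_mul_le {a : ℕ} (ha : 0 < a) :
    ∀ {k n : ℕ}, a * k ≤ n → a ^ k ≤ n.choose k
  | 0, n, _ => by simp
  | k + 1, 0, h => by simp at h; omega
  | k + 1, n + 1, h => by
    have ih : a ^ k ≤ n.choose k := Nat.pow_le_choose_of_mul_le ha (by linarith)
    refine Nat.le_of_mul_le_mul_right ?_ k.succ_pos
    calc a ^ (k + 1) * (k + 1) = (a * (k + 1)) * a ^ k := by ring
      _ ≤ (n + 1) * n.choose k := Nat.mul_le_mul h ih
      _ = (n + 1).choose (k + 1) * (k + 1) := Nat.add_one_mul_choose_eq n k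

lemma pow_mul_choose_add_le (n d j : ℕ) :
    d ^ j * (n * d + j + n).choose n ≤ (d + 1) ^ j * (n * d + n).choose n := by
  induction j with
  | zero => simp
  | succ j ih =>
    have step : d * (n * d + (j + 1) + n).choose n ≤ (d + 1) * (n * d + j + n).choose n := by
      have h := Nat.choose_mul_succ_eq (n * d + j + n) n
      rw [show n * d + j + n + 1 - n = n * d + j + 1 by omega,
        show n * d + j + n + 1 = n * d + (j + 1) + n by ring] at h
      refine Nat.le_of_mul_le_mul_right ?_ (by omega : 0 < n * d + j + 1)
      calc d * (n * d + (j + 1) + n).choose n * (n * d + j + 1)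
          = (n * d + j + n).choose n * (d * (n * d + (j + 1) + n)) := by
            rw [mul_assoc, ← h]; ring
        _ ≤ (n * d + j + n).choose n * ((d + 1) * (n * d + j + 1)) := by
            refine Nat.mul_le_mul_left _ ?_
            nlinarith
        _ = _ := by ring
    calc d ^ (j + 1) * (n * d + (j + 1) + n).choose n
        = d ^ j * (d * (n * d + (j + 1) + n).choose n) := by ring
      _ ≤ d ^ j * ((d + 1) * (n * d + j + n).choose n) := by gcongr
      _ = (d + 1) * (d ^ j * (n * d + j + n).choose n) := by ring
      _ ≤ (d + 1) * ((d + 1) ^ j * (n * d + n).choose n) := by gcongr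
      _ = _ := by ring

lemma add_one_pow_self_le_three_mul {d : ℕ} (hd : 0 < d) : (d + 1) ^ d ≤ 3 * d ^ d := by
  have h := Real.one_add_inv_pow_le_exp (n := d)
  have h3 := Real.exp_one_lt_three
  have hd' : (0 : ℝ) < d := by exact_mod_cast hd
  have : ((d + 1 : ℕ) : ℝ) ^ d = (1 + (d : ℝ)⁻¹) ^ d * d ^ d := by
    rw [← mul_pow]; congr 1; push_cast; field_simp
  have : ((d + 1 : ℕ) : ℝ) ^ d ≤ 3 * d ^ d := by
    rw [this]; gcongr; linarith
  exact_mod_cast this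

lemma choose_add_mul_le_three_pow_mul {d : ℕ} (hd : 0 < d) (n k : ℕ) :
    (n * d + d * k + n).choose n ≤ 3 ^ k * (n * d + n).choose n := by
  refine Nat.le_of_mul_le_mul_left ?_ (pow_pos hd (d * k))
  calc _ ≤ (d + 1) ^ (d * k) * (n * d + n).choose n := pow_mul_choose_add_le n d (d * k)
    _ ≤ (3 * d ^ d) ^ k * (n * d + n).choose n := by
      rw [pow_mul]; gcongr; exact add_one_pow_self_le_three_mul hd
    _ = _ := by rw [mul_pow, ← pow_mul]; ring

lemma choose_add_le_pow_mul_choose {l d m : ℕ} (hd : 0 < d) (hl : l ≤ 2 * d * m) (j : ℕ) :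
    (l + (m + j)).choose (m + j) ≤ (3 * d) ^ j * (l + m).choose m := by
  induction j with
  | zero => simp
  | succ j ih =>
    have h := Nat.add_one_mul_choose_eq (l + (m + j)) (m + j)
    refine Nat.le_of_mul_le_mul_right ?_ (by omega : 0 < m + j + 1)
    calc (l + (m + (j + 1))).choose (m + (j + 1)) * (m + j + 1)
        = (l + (m + j) + 1) * (l + (m + j)).choose (m + j) := h.symm
      _ ≤ (3 * d * (m + j + 1)) * ((3 * d) ^ j * (l + m).choose m) := by
        gcongr; nlinarith
      _ = _ := by ring

section Exponents

variable {σ : Type*} [DecidableEq σ]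

/-- The exponent vectors supported in `A` of degree at most `l`. -/
noncomputable def boundedExponents (A : Finset σ) (l : ℕ) : Finset (σ →₀ ℕ) :=
  (range (l + 1)).biUnion A.finsuppAntidiag

lemma mem_boundedExponents {A : Finset σ} {l : ℕ} {m : σ →₀ ℕ} :
    m ∈ boundedExponents A l ↔ m.degree ≤ l ∧ m.support ⊆ A := by
  simp only [boundedExponents, mem_biUnion, mem_range, Nat.lt_succ_iff, mem_finsuppAntidiag',
    ← and_assoc, exists_and_right]
  exact and_congr_left fun _ => ⟨fun ⟨_, hl, hm⟩ => hm.trans_le hl, fun hm => ⟨_, hm, rfl⟩⟩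

lemma card_boundedExponents (A : Finset σ) (l : ℕ) :
    #(boundedExponents A l) = (l + #A).choose #A := by
  rw [boundedExponents, card_biUnion, ← Nat.sum_range_multichoose]
  · simp [card_finsuppAntidiag_nat_eq_multichoose]
  · intro i _ j _ hij
    rw [Function.onFun, disjoint_left]
    intro m hi hj
    rw [mem_finsuppAntidiag] at hi hj
    exact hij (hi.1.symm.trans hj.1)

/-- The exponent vectors of the multiples, by monomials of degree at most `l` in the same
variables, of the multilinear monomial in the variables outside `S`, for all `S` of size `k`. -/
noncomputable def shiftedExponents (σ : Type*) [DecidableEq σ] [Fintype σ] (k l : ℕ) :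
    Finset (σ →₀ ℕ) :=
  (powersetCard k univ).biUnion fun S : Finset σ =>
    (boundedExponents Sᶜ l).image (Finsupp.indicator Sᶜ (fun _ _ => 1) + ·)

lemma card_shiftedExponents [Fintype σ] (k l : ℕ) :
    #(shiftedExponents σ k l) =
      (Fintype.card σ).choose k * (l + (Fintype.card σ - k)).choose (Fintype.card σ - k) := by
  rw [shiftedExponents, card_biUnion]
  · rw [sum_congr rfl (g := fun _ => (l + (Fintype.card σ - k)).choose (Fintype.card σ - k))]
    · simp
    · intro S hS
      rw [card_image_of_injective _ (add_right_injective _), card_boundedExponents, card_compl,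
        (mem_powersetCard.1 hS).2]
  · intro S _ T _ hST
    rw [Function.onFun, disjoint_left]
    intro u hS hT
    have key : ∀ S : Finset σ,
        u ∈ (boundedExponents Sᶜ l).image (Finsupp.indicator Sᶜ (fun _ _ => 1) + ·) →
          u.support = Sᶜ := by
      intro S hu
      obtain ⟨m, hm, rfl⟩ := mem_image.1 hu
      ext i
      have := @(mem_boundedExponents.1 hm).2 i
      by_cases hi : i ∈ S <;> simp_all [Finsupp.indicator_apply]
    exact hST (compl_injective ((key S hS).symm.trans (key T hT)))

end Exponents

section Derivatives

variable {σ R : Type*} [CommSemiring R]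

lemma MvPolynomial.totalDegree_pderiv_le (i : σ) (p : MvPolynomial σ R) :
    (pderiv i p).totalDegree ≤ p.totalDegree := by
  conv_lhs => rw [p.as_sum, map_sum]
  refine totalDegree_finsetSum_le fun m hm => ?_
  rw [pderiv_monomial]
  refine (totalDegree_monomial_le _ _).trans (le_trans ?_ (le_totalDegree hm))
  exact Finsupp.degree_mono tsub_le_self

lemma MvPolynomial.exists_pderiv_pow_mul {d : ℕ} (i : σ) (Q R' : MvPolynomial σ R) (a b : ℕ)
    (hQ : Q.totalDegree ≤ d) (hR : R'.totalDegree ≤ b) :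
    ∃ T : MvPolynomial σ R, T.totalDegree ≤ d + b ∧ pderiv i (Q ^ a * R') = Q ^ (a - 1) * T := by
  have hR' := (totalDegree_pderiv_le i R').trans hR
  have hQ' := (totalDegree_pderiv_le i Q).trans hQ
  obtain _ | a := a
  · exact ⟨pderiv i R', by omega, by simp⟩
  · refine ⟨((a + 1 : ℕ) : R) • (pderiv i Q * R') + Q * pderiv i R', ?_, ?_⟩
    · refine (totalDegree_add _ _).trans (max_le ((totalDegree_smul_le _ _).trans ?_) ?_)
      · exact (totalDegree_mul _ _).trans (by omega)
      · exact (totalDegree_mul _ _).trans (by omega)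
    · rw [pderiv_mul, pderiv_pow, smul_eq_C_mul]
      simp only [map_natCast, Nat.add_sub_cancel]
      ring

lemma MvPolynomial.exists_linearMap_iterated_pderiv [DecidableEq σ] [Fintype σ] (S : Finset σ) :
    ∃ L : MvPolynomial σ R →ₗ[R] MvPolynomial σ R,
      L (∏ i, X i) = monomial (Finsupp.indicator Sᶜ (fun _ _ => 1)) 1 ∧
      ∀ (d a : ℕ) (Q : MvPolynomial σ R), Q.totalDegree ≤ d →
        ∃ T : MvPolynomial σ R, T.totalDegree ≤ d * #S ∧ L (Q ^ a) = Q ^ (a - #S) * T := by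
  induction S using Finset.induction_on with
  | empty =>
    refine ⟨LinearMap.id, ?_, fun d a Q _ => ⟨1, by simp, by simp⟩⟩
    rw [monomial_eq, Finsupp.prod_fintype _ _ (by simp)]
    simp [Finsupp.indicator_apply]
  | insert i S hi ih =>
    obtain ⟨L, hL, hpow⟩ := ih
    refine ⟨(pderiv i).toLinearMap ∘ₗ L, ?_, fun d a Q hQ => ?_⟩
    · simp only [LinearMap.comp_apply, hL, Derivation.coeFn_coe, pderiv_monomial]
      congr 1
      · congr 1
        ext j
        by_cases hj : i = j
        · subst hj; simp [Finsupp.indicator_apply, hi]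
        · simp [Finsupp.indicator_apply, Ne.symm hj]
      · simp [Finsupp.indicator_apply, hi]
    · obtain ⟨T, hT, hTL⟩ := hpow d a Q hQ
      obtain ⟨T', hT', h⟩ := exists_pderiv_pow_mul i Q T (a - #S) (d * #S) hQ hT
      refine ⟨T', ?_, ?_⟩
      · rw [card_insert_of_notMem hi]; linarith
      · simp only [LinearMap.comp_apply, hTL, Derivation.coeFn_coe, h, card_insert_of_notMem hi,
          Nat.sub_sub]

end Derivatives

section Field

variable {F σ : Type*} [Field F] [Fintype σ]

theorem choose_mul_choose_le_of_prod_X_eq_sum_pow {d s : ℕ}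
    {Q : Fin s → MvPolynomial σ F} {e : Fin s → ℕ} (hQ : ∀ i, (Q i).totalDegree ≤ d)
    (h : ∏ i, X i = ∑ i, Q i ^ e i) (k l : ℕ) :
    (Fintype.card σ).choose k * (l + (Fintype.card σ - k)).choose (Fintype.card σ - k) ≤
      s * (l + d * k + Fintype.card σ).choose (Fintype.card σ) := by
  classical
  let W : Finset (MvPolynomial σ F) :=
    (univ ×ˢ boundedExponents (univ : Finset σ) (l + d * k)).image
      fun p => Q p.1 ^ (e p.1 - k) * monomial p.2 1
  have hW : #W ≤ s * (l + d * k + Fintype.card σ).choose (Fintype.card σ) := by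
    refine card_image_le.trans_eq ?_
    simp [card_product, card_boundedExponents]
  have mem_W (i : Fin s) (T : MvPolynomial σ F) (hT : T.totalDegree ≤ l + d * k) :
      Q i ^ (e i - k) * T ∈ Submodule.span F (W : Set (MvPolynomial σ F)) := by
    rw [T.as_sum, mul_sum]
    refine Submodule.sum_mem _ fun m hm => ?_
    rw [← mul_one (coeff m T), ← smul_eq_mul (coeff m T), ← smul_monomial, mul_smul_comm]
    refine Submodule.smul_mem _ _ (Submodule.subset_span ?_)
    refine mem_coe.2 (mem_image.2 ⟨(i, m), ?_, rfl⟩)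
    exact mem_product.2 ⟨mem_univ _,
      mem_boundedExponents.2 ⟨(le_totalDegree hm).trans hT, subset_univ _⟩⟩
  have mem_span (u : σ →₀ ℕ) (hu : u ∈ shiftedExponents σ k l) :
      monomial u (1 : F) ∈ Submodule.span F (W : Set (MvPolynomial σ F)) := by
    obtain ⟨S, hS, hu⟩ := mem_biUnion.1 hu
    obtain ⟨m, hm, rfl⟩ := mem_image.1 hu
    obtain ⟨L, hL, hpow⟩ := exists_linearMap_iterated_pderiv (R := F) S
    rw [(mem_powersetCard.1 hS).2] at hpow
    have : monomial (Finsupp.indicator Sᶜ (fun _ _ => 1) + m) (1 : F) =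
        ∑ i, L (Q i ^ e i) * monomial m 1 := by
      rw [← sum_mul, ← map_sum, ← h, hL, monomial_mul, one_mul]
    rw [this]
    refine Submodule.sum_mem _ fun i _ => ?_
    obtain ⟨T, hT, hLT⟩ := hpow d (e i) (Q i) (hQ i)
    rw [hLT, mul_assoc]
    refine mem_W i _ ((totalDegree_mul _ _).trans ?_)
    have h1 : (monomial m (1 : F)).totalDegree ≤ l :=
      (totalDegree_monomial_le _ _).trans (mem_boundedExponents.1 hm).1
    omega
  rw [← card_shiftedExponents]
  refine le_trans ?_ hW
  have hli : LinearIndependent F fun u : shiftedExponents σ k l => monomial u.1 (1 : F) := by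
    have := (basisMonomials σ F).linearIndependent.comp
      (Subtype.val : shiftedExponents σ k l → σ →₀ ℕ) Subtype.val_injective
    simpa [Function.comp_def] using this
  have := linearIndependent_le_span_aux' _ hli (W : Set (MvPolynomial σ F))
    (by rintro _ ⟨u, rfl⟩; exact mem_span u.1 u.2)
  simpa using this

theorem two_pow_le_of_prod_X_eq_sum_pow {d s k : ℕ} (hd : 0 < d)
    (hk : 18 * d * k ≤ Fintype.card σ)
    {Q : Fin s → MvPolynomial σ F} {e : Fin s → ℕ} (hQ : ∀ i, (Q i).totalDegree ≤ d)
    (h : ∏ i, X i = ∑ i, Q i ^ e i) : 2 ^ k ≤ s := by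
  have main := choose_mul_choose_le_of_prod_X_eq_sum_pow hQ h k (Fintype.card σ * d)
  generalize Fintype.card σ = n at *
  have hkn : 18 * k ≤ n := by nlinarith
  obtain ⟨m, rfl⟩ : ∃ m, n = m + k := ⟨n - k, by omega⟩
  rw [Nat.add_sub_cancel] at main
  have hA := Nat.pow_le_choose_of_mul_le (by omega : 0 < 18 * d) hk
  have hB := choose_add_mul_le_three_pow_mul hd (m + k) k
  have hC := choose_add_le_pow_mul_choose (l := (m + k) * d) (m := m) hd (by nlinarith) k
  have hpos : 0 < ((m + k) * d + m).choose m := Nat.choose_pos (by omega)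
  refine Nat.le_of_mul_le_mul_right ?_
    (Nat.mul_pos (pow_pos (by omega : 0 < 9 * d) k) hpos)
  calc 2 ^ k * ((9 * d) ^ k * ((m + k) * d + m).choose m)
      = (18 * d) ^ k * ((m + k) * d + m).choose m := by
        rw [← mul_assoc, ← mul_pow]; ring_nf
    _ ≤ (m + k).choose k * ((m + k) * d + m).choose m := by gcongr
    _ ≤ s * (3 ^ k * ((3 * d) ^ k * ((m + k) * d + m).choose m)) :=
        main.trans (by gcongr; exact hB.trans (by gcongr))
    _ = _ := by rw [← mul_assoc (3 ^ k), ← mul_pow]; ring_nf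

theorem two_le_of_prod_X_eq_sum_pow {d s : ℕ} (hd : 0 < d) (hdn : d < Fintype.card σ)
    {Q : Fin s → MvPolynomial σ F} {e : Fin s → ℕ} (hQ : ∀ i, (Q i).totalDegree ≤ d)
    (h : ∏ i, X i = ∑ i, Q i ^ e i) : 2 ≤ s := by
  classical
  have hprod : (∏ i : σ, X i : MvPolynomial σ F) ≠ 0 := prod_ne_zero_iff.2 fun i _ => X_ne_zero i
  by_contra! hs
  obtain rfl | rfl : s = 0 ∨ s = 1 := by omega
  · simp_all
  · rw [Fin.sum_univ_one] at h
    obtain ⟨i⟩ : Nonempty σ := Fintype.card_pos_iff.1 (hd.trans hdn)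
    have hdeg : (∏ i : σ, X i : MvPolynomial σ F).totalDegree = Fintype.card σ := by
      simpa using
        (IsHomogeneous.prod univ X (fun _ => 1) fun j _ => isHomogeneous_X F j).totalDegree hprod
    have he : e 0 = 1 := by
      have := congrArg (aeval fun j => if j = i then (Polynomial.X : Polynomial F) else 1) h
      simp [prod_ite_eq'] at this
      have := congrArg Polynomial.natDegree this
      simp at this
      exact (mul_eq_one.1 this.symm).1
    rw [he, pow_one] at h
    have := hQ 0
    rw [← h, hdeg] at this
    omega

end Field

/-- a lower bound on the number of summands needed to write the
multilinear monomial `x_1⋯x_n` as a sum of powers of low-degree polynomials. -/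
theorem stmt16 : ∃ c : ℝ, 0 < c ∧
    ∀ (F : Type*) [Field F], ∀ n d : ℕ, 0 < n → 0 < d →
      2 * Real.exp 1 * (d : ℝ) ≤ (n : ℝ) →
      ∀ (s : ℕ) (Q : Fin s → MvPolynomial (Fin n) F) (e : Fin s → ℕ),
        (∀ i, (Q i).totalDegree ≤ d) → (∀ i, 0 < e i) →
        (∏ i : Fin n, MvPolynomial.X i) = ∑ i, Q i ^ e i →
        (2 : ℝ) ^ (c * (n : ℝ) / (d : ℝ)) ≤ (s : ℝ) := by
  refine ⟨1 / 36, by norm_num, fun F _ n d _ hd hdn s Q e hQ _ h => ?_⟩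
  have hd' : (0 : ℝ) < d := by exact_mod_cast hd
  have hlt : d < n := by
    have : (d : ℝ) < n := by nlinarith [Real.add_one_le_exp 1]
    exact_mod_cast this
  have h2 := two_le_of_prod_X_eq_sum_pow hd (by simpa using hlt) hQ h
  have hk := two_pow_le_of_prod_X_eq_sum_pow (k := n / (18 * d)) hd
    (by simpa using Nat.mul_div_le n (18 * d)) hQ h
  have hmax : 2 ^ max 1 (n / (18 * d)) ≤ s := by
    rcases max_cases 1 (n / (18 * d)) with ⟨hm, _⟩ | ⟨hm, _⟩ <;> rw [hm] <;> simpa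
  have hexp : 1 / 36 * (n : ℝ) / d ≤ (max 1 (n / (18 * d)) : ℕ) := by
    rw [div_le_iff₀ hd']
    have hn : n ≤ 36 * (max 1 (n / (18 * d)) * d) := by
      have hlt := Nat.lt_mul_div_succ n (by omega : 0 < 18 * d)
      have h1 : n / (18 * d) + 1 ≤ 2 * max 1 (n / (18 * d)) := by omega
      have h2 := Nat.mul_le_mul_left (18 * d) h1
      linarith
    have : (n : ℝ) ≤ 36 * ((max 1 (n / (18 * d)) : ℕ) * d) := by exact_mod_cast hn
    linarith
  calc (2 : ℝ) ^ (1 / 36 * (n : ℝ) / d) ≤ 2 ^ ((max 1 (n / (18 * d)) : ℕ) : ℝ) :=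
        Real.rpow_le_rpow_of_exponent_le one_le_two hexp
    _ = ((2 ^ max 1 (n / (18 * d)) : ℕ) : ℝ) := by rw [Real.rpow_natCast]; push_cast; rfl
    _ ≤ s := by exact_mod_cast hmax
end
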